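/- Let X be a real Banach space equipped with a module multiplication (a, x) ↦ a·x by bounded sequences a : ℕ → ℝ which is bilinear, satisfies ‖a·x‖ ≤ ‖a‖_∞‖x‖ and 1_ℕ·x = x, and let X⁰ = {x ∈ X : x = 1_A·x for some finite A ⊆ ℕ} be the submodule of finitely supported elements. Let φ : X⁰ → ℝ be a homogeneous quasilinear map, i.e., |φ(x+y) − φ(x) − φ(y)| ≤ Q(‖x‖ + ‖y‖) for some constant Q and all x, y ∈ X⁰. Then there exist a homogeneous map Φ : X⁰ → ℓ₁ and constants C and C' (depending only on Q) such that ‖Φ(a·x) − a·Φ(x)‖₁ ≤ C'‖a‖_∞‖x‖ for every bounded sequence a and x ∈ X⁰ (so Φ is a centralizer), and |φ(x) − Σ_n Φ(x)(n)| ≤ C‖x‖ for all x ∈ X⁰. -/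

import Mathlib

open scoped ENNReal

/-- The Banach algebra `ℓ_∞` of bounded real sequences. -/
noncomputable abbrev Linf : Type := lp (fun _ : ℕ => ℝ) ∞

/-- The indicator sequence `1_A` of a finite set `A ⊆ ℕ`, as an element of `ℓ_∞`. -/
noncomputable def indLp (A : Finset ℕ) : Linf :=
  ⟨fun n => if n ∈ A then (1 : ℝ) else 0, by
    apply memℓp_infty
    refine ⟨1, ?_⟩
    rintro r ⟨n, rfl⟩
    dsimp
    split <;> simp⟩

/-- An element `x` of an `ℓ_∞`-module `X` is finitely supported (i.e. belongs to `X⁰`)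
if `x = 1_A • x` for some finite `A ⊆ ℕ`. -/
def FinSuppX {X : Type*} [AddCommGroup X] [Module Linf X] (x : X) : Prop :=
  ∃ A : Finset ℕ, indLp A • x = x

/-- The `ℓ₁` norm of a sequence, `‖f‖₁ = ∑ₙ |f n|`. -/
noncomputable def l1Norm (f : ℕ → ℝ) : ℝ := ∑' n, |f n|

theorem self_pow_le_three_pow_mul_factorial (s : ℕ) : s ^ s ≤ 3 ^ s * s.factorial := by
  have h := Real.pow_div_factorial_le_exp (s : ℝ) (Nat.cast_nonneg s) s
  rw [div_le_iff₀ (by positivity), ← mul_one (s : ℝ), Real.exp_nat_mul, mul_one] at h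
  have h3 : Real.exp 1 ≤ 3 := by linarith [Real.exp_one_lt_d9]
  have : ((s ^ s : ℕ) : ℝ) ≤ ((3 ^ s * s.factorial : ℕ) : ℝ) := by
    push_cast
    exact h.trans (by gcongr)
  exact_mod_cast this

theorem four_pow_mul_choose_mul_choose_le {k s : ℕ} (hs : s ≤ 2 * k) :
    4 ^ s * ((4 * k).choose s * (3 * k).choose s * s ^ (12 * s)) ≤ (3 * k) ^ (12 * s) := by
  have h1 : (4 * k).choose s * s.factorial ≤ (4 * k) ^ s := by
    rw [mul_comm, ← Nat.descFactorial_eq_factorial_mul_choose]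
    exact Nat.descFactorial_le_pow _ _
  have h2 : (3 * k).choose s * s.factorial ≤ (3 * k) ^ s := by
    rw [mul_comm, ← Nat.descFactorial_eq_factorial_mul_choose]
    exact Nat.descFactorial_le_pow _ _
  have h3 := self_pow_le_three_pow_mul_factorial s
  have h4 : s ^ s ≤ (2 * k) ^ s := Nat.pow_le_pow_left hs s
  calc 4 ^ s * ((4 * k).choose s * (3 * k).choose s * s ^ (12 * s))
      = 4 ^ s * ((4 * k).choose s * (3 * k).choose s * ((s ^ s) * (s ^ s) * (s ^ s) ^ 10)) := by
        ring
    _ ≤ 4 ^ s * ((4 * k).choose s * (3 * k).choose s *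
          ((3 ^ s * s.factorial) * (3 ^ s * s.factorial) * ((2 * k) ^ s) ^ 10)) := by gcongr
    _ = 4 ^ s * (3 ^ s * 3 ^ s * (((4 * k).choose s * s.factorial) *
          ((3 * k).choose s * s.factorial)) * ((2 * k) ^ s) ^ 10) := by ring
    _ ≤ 4 ^ s * (3 ^ s * 3 ^ s * ((4 * k) ^ s * (3 * k) ^ s) * ((2 * k) ^ s) ^ 10) := by gcongr
    _ = (4 * (3 * 3 * ((4 * k) * (3 * k)) * (2 * k) ^ 10)) ^ s := by
        simp only [mul_pow, ← pow_mul, mul_comm s 10]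
    _ ≤ ((3 * k) ^ 12) ^ s := by
        apply Nat.pow_le_pow_left
        have : 4 * (3 * 3 * ((4 * k) * (3 * k)) * (2 * k) ^ 10) = 442368 * k ^ 12 := by ring
        rw [this, mul_pow]
        gcongr
        norm_num
    _ = (3 * k) ^ (12 * s) := by rw [← pow_mul]

/-- Existence of concentrators: a bipartite graph with `4k` inputs, `3k` outputs and left degree
at most `12` in which every set of at most `2k` inputs satisfies Hall's condition. -/
theorem exists_concentrator (k : ℕ) :
    ∃ N : Fin (4 * k) → Finset (Fin (3 * k)), (∀ i, (N i).card ≤ 12) ∧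
      ∀ S : Finset (Fin (4 * k)), S.card ≤ 2 * k → S.card ≤ (S.biUnion N).card := by
  classical
  suffices h : ∃ g : Fin (4 * k) → Fin 12 → Fin (3 * k), ∀ S : Finset (Fin (4 * k)),
      S.card ≤ 2 * k → S.card ≤ (S.biUnion fun i => Finset.univ.image (g i)).card by
    obtain ⟨g, hg⟩ := h
    exact ⟨fun i => Finset.univ.image (g i),
      fun i => Finset.card_image_le.trans (by simp), hg⟩
  by_contra! hbad
  let bad (S : Finset (Fin (4 * k))) (T : Finset (Fin (3 * k))) :
      Finset (Fin (4 * k) → Fin 12 → Fin (3 * k)) :=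
    Fintype.piFinset fun i => Fintype.piFinset fun _ => if i ∈ S then T else Finset.univ
  have hcover : (Finset.univ : Finset (Fin (4 * k) → Fin 12 → Fin (3 * k))) ⊆
      (Finset.Icc 1 (2 * k)).biUnion fun s => (Finset.univ.powersetCard s).biUnion fun S =>
        (Finset.univ.powersetCard s).biUnion fun T => bad S T := by
    intro g _
    obtain ⟨S, hS, hlt⟩ := hbad g
    obtain ⟨T, hNT, -, hT⟩ := Finset.exists_subsuperset_card_eq
      (Finset.subset_univ (S.biUnion fun i => Finset.univ.image (g i))) hlt.le
      (by simp; omega)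
    simp only [Finset.mem_biUnion, Finset.mem_Icc, Finset.mem_powersetCard, Finset.subset_univ,
      true_and]
    refine ⟨S.card, ⟨by omega, hS⟩, S, rfl, T, hT, ?_⟩
    simp only [bad, Fintype.mem_piFinset]
    intro i r
    split_ifs with hi
    · exact hNT (Finset.mem_biUnion.2 ⟨i, hi, Finset.mem_image_of_mem _ (Finset.mem_univ r)⟩)
    · exact Finset.mem_univ _
  have hcard : ∀ s, ∀ S ∈ (Finset.univ : Finset (Fin (4 * k))).powersetCard s,
      ∀ T ∈ (Finset.univ : Finset (Fin (3 * k))).powersetCard s,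
      (bad S T).card = s ^ (12 * s) * (3 * k) ^ (12 * (4 * k - s)) := by
    intro s S hS T hT
    rw [Finset.mem_powersetCard] at hS hT
    simp only [bad, Fintype.card_piFinset, Finset.prod_const, Finset.card_univ, Fintype.card_fin]
    have : ∀ i, (if i ∈ S then T else Finset.univ).card ^ 12 =
        if i ∈ S then s ^ 12 else (3 * k) ^ 12 := by
      intro i
      split_ifs <;> simp [hT.2]
    simp only [this]
    rw [Finset.prod_ite, Finset.prod_const, Finset.prod_const]
    have e1 : (Finset.univ.filter fun i => i ∈ S).card = s := by simp [hS.2]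
    have e2 : (Finset.univ.filter fun i => i ∉ S).card = 4 * k - s := by
      rw [← Finset.compl_filter, Finset.card_compl, e1, Fintype.card_fin]
    rw [e1, e2, ← pow_mul, ← pow_mul]
  have hle : (3 * k) ^ (12 * (4 * k)) ≤ ∑ s ∈ Finset.Icc 1 (2 * k),
      (4 * k).choose s * (3 * k).choose s * (s ^ (12 * s) * (3 * k) ^ (12 * (4 * k - s))) := by
    calc (3 * k) ^ (12 * (4 * k))
        = (Finset.univ : Finset (Fin (4 * k) → Fin 12 → Fin (3 * k))).card := by
          simp [← pow_mul]
      _ ≤ _ := Finset.card_le_card hcover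
      _ ≤ _ := Finset.card_biUnion_le
      _ ≤ _ := by
          refine Finset.sum_le_sum fun s _ => ?_
          refine Finset.card_biUnion_le.trans ?_
          refine (Finset.sum_le_card_nsmul _ _
            ((3 * k).choose s * (s ^ (12 * s) * (3 * k) ^ (12 * (4 * k - s)))) ?_).trans ?_
          · intro S hS
            refine Finset.card_biUnion_le.trans ?_
            refine (Finset.sum_le_card_nsmul _ _ _ fun T hT => (hcard s S hS T hT).le).trans ?_
            simp
          · simp [mul_assoc]
  have hterm : ∀ s ∈ Finset.Icc 1 (2 * k),
      (((4 * k).choose s * (3 * k).choose s * (s ^ (12 * s) * (3 * k) ^ (12 * (4 * k - s))) : ℕ)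
        : ℝ) ≤ (1 / 4) ^ s * ((3 * k) ^ (12 * (4 * k)) : ℕ) := by
    intro s hs
    rw [Finset.mem_Icc] at hs
    have h := four_pow_mul_choose_mul_choose_le hs.2
    have h' := Nat.mul_le_mul_right ((3 * k) ^ (12 * (4 * k - s))) h
    rw [← pow_add, show 12 * s + 12 * (4 * k - s) = 12 * (4 * k) by omega] at h'
    have h'' : ((4 ^ s * ((4 * k).choose s * (3 * k).choose s * s ^ (12 * s)) *
        (3 * k) ^ (12 * (4 * k - s)) : ℕ) : ℝ) ≤ ((3 * k) ^ (12 * (4 * k)) : ℕ) := by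
      exact_mod_cast h'
    rw [one_div, inv_pow, inv_mul_eq_div, le_div_iff₀ (by positivity)]
    refine le_trans (le_of_eq ?_) h''
    push_cast
    ring
  have hgeom : ∀ n : ℕ, ∑ s ∈ Finset.Icc 1 n, (1 / 4 : ℝ) ^ s ≤ 1 / 3 - (1 / 4) ^ n / 3 := by
    intro n
    induction n with
    | zero => simp
    | succ n ih =>
      rw [Finset.sum_Icc_succ_top (by omega)]
      rw [pow_succ]
      linarith
  have hpos : (0 : ℝ) < ((3 * k) ^ (12 * (4 * k)) : ℕ) := by
    rcases Nat.eq_zero_or_pos k with rfl | hk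
    · simp
    · positivity
  have hle' : (((3 * k) ^ (12 * (4 * k)) : ℕ) : ℝ) ≤
      (∑ s ∈ Finset.Icc 1 (2 * k), (1 / 4 : ℝ) ^ s) * ((3 * k) ^ (12 * (4 * k)) : ℕ) := by
    rw [Finset.sum_mul]
    refine le_trans ?_ (Finset.sum_le_sum hterm)
    exact_mod_cast hle
  have h13 := hgeom (2 * k)
  have : (0 : ℝ) ≤ (1 / 4) ^ (2 * k) / 3 := by positivity
  nlinarith

/-- A nonnegative flow from the inputs `α` to the outputs `β`, carried by the bipartite graph `N`,
with supply `v` and all output capacities equal to one. -/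
structure IsFlow {α β : Type*} [Fintype α] [Fintype β] (N : α → Finset β) (v : α → ℝ)
    (G : α → β → ℝ) : Prop where
  nonneg : ∀ i j, 0 ≤ G i j
  support : ∀ i, ∀ j ∉ N i, G i j = 0
  supply : ∀ i, ∑ j, G i j = v i
  capacity : ∀ j, ∑ i, G i j ≤ 1

section Flow

variable {α β : Type*} [Fintype α] [Fintype β]

theorem IsFlow.convexComb {N : α → Finset β} {u v : α → ℝ} {G H : α → β → ℝ}
    (hG : IsFlow N u G) (hH : IsFlow N v H) {a b : ℝ} (ha : 0 ≤ a) (hb : 0 ≤ b) (hab : a + b = 1) :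
    IsFlow N (a • u + b • v) (a • G + b • H) where
  nonneg i j := by
    have h1 := hG.nonneg i j
    have h2 := hH.nonneg i j
    simp only [Pi.add_apply, Pi.smul_apply, smul_eq_mul]
    positivity
  support i j hj := by simp [hG.support i j hj, hH.support i j hj]
  supply i := by simp [Finset.sum_add_distrib, ← Finset.mul_sum, hG.supply, hH.supply]
  capacity j := by
    simp only [Pi.add_apply, Pi.smul_apply, smul_eq_mul, Finset.sum_add_distrib, ← Finset.mul_sum]
    nlinarith [hG.capacity j, hH.capacity j]

theorem exists_isFlow_of_zero_or_one [DecidableEq β] {N : α → Finset β} {m : ℕ}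
    (hN : ∀ S : Finset α, S.card ≤ m → S.card ≤ (S.biUnion N).card) {v : α → ℝ}
    (hv : ∀ i, v i = 0 ∨ v i = 1) (hsum : ∑ i, v i ≤ m) : ∃ G, IsFlow N v G := by
  classical
  let S : Finset α := Finset.univ.filter fun i => v i = 1
  have hvS : ∀ i, v i = if i ∈ S then 1 else 0 := by
    intro i
    rcases hv i with h | h <;> simp [S, h]
  have hS : S.card ≤ m := by
    have : ∑ i, v i = S.card := by simp [hvS]
    rw [this] at hsum
    exact_mod_cast hsum
  obtain ⟨f, hf, hfN⟩ := (Finset.all_card_le_biUnion_card_iff_exists_injective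
    (fun i : S => N i)).1 (fun s => by
      have h := hN (s.map (Function.Embedding.subtype _)) (by
        rw [Finset.card_map]
        exact (Finset.card_le_univ s).trans (by simpa using hS))
      rw [Finset.card_map] at h
      refine h.trans (le_of_eq ?_)
      congr 1
      ext j
      simp)
  refine ⟨fun i j => if h : i ∈ S then (if f ⟨i, h⟩ = j then 1 else 0) else 0, ?_, ?_, ?_, ?_⟩
  · intro i j
    split_ifs <;> norm_num
  · intro i j hj
    split_ifs with h1 h2
    · exact absurd (h2 ▸ hfN ⟨i, h1⟩) hj
    · rfl
    · rfl
  · intro i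
    rw [hvS]
    split_ifs with h <;> simp
  · intro j
    have h0 : ∀ i, (if h : i ∈ S then (if f ⟨i, h⟩ = j then (1 : ℝ) else 0) else 0) =
        if i ∈ Finset.univ.filter (fun i => ∃ h : i ∈ S, f ⟨i, h⟩ = j) then 1 else 0 := by
      intro i
      by_cases h : i ∈ S <;> simp [h]
    simp only [h0, Finset.sum_ite_mem, Finset.univ_inter, Finset.sum_const, nsmul_eq_mul, mul_one]
    norm_cast
    rw [Finset.card_le_one]
    intro a ha b hb
    simp only [Finset.mem_filter, Finset.mem_univ, true_and] at ha hb
    obtain ⟨ha, ha'⟩ := ha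
    obtain ⟨hb, hb'⟩ := hb
    simpa using hf (ha'.trans hb'.symm)

/-- A graph satisfying Hall's condition for sets of at most `m` inputs carries a flow for every
supply with values in `[0, 1]` and total at most `m`. -/
theorem exists_isFlow [DecidableEq β] {N : α → Finset β} {m : ℕ}
    (hN : ∀ S : Finset α, S.card ≤ m → S.card ≤ (S.biUnion N).card) {v : α → ℝ}
    (hv0 : ∀ i, 0 ≤ v i) (hv1 : ∀ i, v i ≤ 1) (hsum : ∑ i, v i ≤ m) : ∃ G, IsFlow N v G := by
  classical
  induction hn : (Finset.univ.filter fun i => v i ≠ 0 ∧ v i ≠ 1).card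
    using Nat.strong_induction_on generalizing v with
  | _ n ih =>
  subst hn
  -- It suffices to move in a direction `d` both ways, each time losing a fractional coordinate.
  have key : ∀ (d : α → ℝ) (s t : ℝ), 0 < s → 0 < t → (∀ i, v i = 0 ∨ v i = 1 → d i = 0) →
      (∀ i, 0 ≤ v i + s * d i) → (∀ i, v i + s * d i ≤ 1) → (∑ i, (v i + s * d i) ≤ m) →
      (∃ i, (v i ≠ 0 ∧ v i ≠ 1) ∧ (v i + s * d i = 0 ∨ v i + s * d i = 1)) →
      (∀ i, 0 ≤ v i - t * d i) → (∀ i, v i - t * d i ≤ 1) → (∑ i, (v i - t * d i) ≤ m) →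
      (∃ i, (v i ≠ 0 ∧ v i ≠ 1) ∧ (v i - t * d i = 0 ∨ v i - t * d i = 1)) →
      ∃ G, IsFlow N v G := by
    intro d s t hs ht hd a0 a1 am ai b0 b1 bm bi
    have less : ∀ u : α → ℝ, (∀ i, v i = 0 ∨ v i = 1 → u i = v i) →
        (∃ i, (v i ≠ 0 ∧ v i ≠ 1) ∧ (u i = 0 ∨ u i = 1)) →
        (Finset.univ.filter fun i => u i ≠ 0 ∧ u i ≠ 1).card <
          (Finset.univ.filter fun i => v i ≠ 0 ∧ v i ≠ 1).card := by
      intro u hu ⟨i, hi, hui⟩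
      apply Finset.card_lt_card
      rw [Finset.ssubset_iff_of_subset]
      · refine ⟨i, by simpa using hi, ?_⟩
        simp only [Finset.mem_filter, Finset.mem_univ, true_and]
        tauto
      · intro l hl
        simp only [Finset.mem_filter, Finset.mem_univ, true_and] at hl ⊢
        by_contra hcon
        have hl' : v l = 0 ∨ v l = 1 := by tauto
        rw [hu l hl'] at hl
        tauto
    obtain ⟨G, hG⟩ := ih _ (less (fun i => v i + s * d i) (fun i hi => by simp [hd i hi]) ai)
      a0 a1 am rfl
    obtain ⟨H, hH⟩ := ih _ (less (fun i => v i - t * d i) (fun i hi => by simp [hd i hi]) bi)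
      b0 b1 bm rfl
    have hst : 0 < s + t := by positivity
    have h := hG.convexComb hH (a := t / (s + t)) (b := s / (s + t)) (by positivity)
      (by positivity) (by field_simp; ring)
    have hcomb : ((t / (s + t)) • (fun i => v i + s * d i) +
        (s / (s + t)) • fun i => v i - t * d i) = v := by
      funext i
      simp only [Pi.add_apply, Pi.smul_apply, smul_eq_mul]
      field_simp
      ring
    rw [hcomb] at h
    exact ⟨_, h⟩
  by_cases hfrac : ∃ i, v i ≠ 0 ∧ v i ≠ 1
  swap
  · push Not at hfrac
    exact exists_isFlow_of_zero_or_one hN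
      (fun i => (em (v i = 0)).imp id (hfrac i)) hsum
  obtain ⟨i, hi⟩ := hfrac
  have hi0 : 0 < v i := lt_of_le_of_ne (hv0 i) (Ne.symm hi.1)
  have hi1 : v i < 1 := lt_of_le_of_ne (hv1 i) hi.2
  by_cases htwo : ∃ j, j ≠ i ∧ v j ≠ 0 ∧ v j ≠ 1
  · obtain ⟨j, hji, hj⟩ := htwo
    have hj0 : 0 < v j := lt_of_le_of_ne (hv0 j) (Ne.symm hj.1)
    have hj1 : v j < 1 := lt_of_le_of_ne (hv1 j) hj.2
    let d : α → ℝ := Pi.single i 1 - Pi.single j 1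
    have di : d i = 1 := by simp [d, hji.symm]
    have dj : d j = -1 := by simp [d, hji]
    have dl : ∀ l, l ≠ i → l ≠ j → d l = 0 := by
      intro l h1 h2
      simp [d, h1, h2]
    have dsum : ∑ l, d l = 0 := by simp [d]
    have all : ∀ p : α → Prop, p i → p j → (∀ l, l ≠ i → l ≠ j → p l) → ∀ l, p l := by
      intro p h1 h2 h3 l
      by_cases e1 : l = i
      · exact e1 ▸ h1
      by_cases e2 : l = j
      · exact e2 ▸ h2
      exact h3 l e1 e2
    have s1 := min_le_left (1 - v i) (v j)
    have s2 := min_le_right (1 - v i) (v j)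
    have t1 := min_le_left (v i) (1 - v j)
    have t2 := min_le_right (v i) (1 - v j)
    have spos : 0 < min (1 - v i) (v j) := lt_min (by linarith) hj0
    have tpos : 0 < min (v i) (1 - v j) := lt_min hi0 (by linarith)
    refine key d (min (1 - v i) (v j)) (min (v i) (1 - v j)) spos tpos ?_
      (all _ ?_ ?_ ?_) (all _ ?_ ?_ ?_) ?_ ?_ (all _ ?_ ?_ ?_) (all _ ?_ ?_ ?_) ?_ ?_
    · intro l hl
      refine dl l ?_ ?_
      · rintro rfl
        tauto
      · rintro rfl
        tauto
    · rw [di]; linarith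
    · rw [dj]; linarith
    · intro l h1 h2; rw [dl l h1 h2]; linarith [hv0 l]
    · rw [di]; linarith
    · rw [dj]; linarith
    · intro l h1 h2; rw [dl l h1 h2]; linarith [hv1 l]
    · rw [Finset.sum_add_distrib, ← Finset.mul_sum, dsum]; linarith
    · rcases min_choice (1 - v i) (v j) with h | h
      · exact ⟨i, hi, Or.inr (by rw [di, h]; ring)⟩
      · exact ⟨j, hj, Or.inl (by rw [dj, h]; ring)⟩
    · rw [di]; linarith
    · rw [dj]; linarith
    · intro l h1 h2; rw [dl l h1 h2]; linarith [hv0 l]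
    · rw [di]; linarith
    · rw [dj]; linarith
    · intro l h1 h2; rw [dl l h1 h2]; linarith [hv1 l]
    · rw [Finset.sum_sub_distrib, ← Finset.mul_sum, dsum]; linarith
    · rcases min_choice (v i) (1 - v j) with h | h
      · exact ⟨i, hi, Or.inl (by rw [di, h]; ring)⟩
      · exact ⟨j, hj, Or.inr (by rw [dj, h]; ring)⟩
  · push Not at htwo
    have hint : ∀ l, l ≠ i → v l = 0 ∨ v l = 1 := fun l hl =>
      (em (v l = 0)).imp id (htwo l hl)
    obtain ⟨c, hc⟩ : ∃ c : ℕ, ∑ l ∈ Finset.univ.erase i, v l = c := by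
      refine ⟨((Finset.univ.erase i).filter fun l => v l = 1).card, ?_⟩
      rw [Finset.card_filter]
      push_cast
      refine Finset.sum_congr rfl fun l hl => ?_
      rcases hint l (Finset.ne_of_mem_erase hl) with h | h <;> simp [h]
    have hsplit := Finset.add_sum_erase Finset.univ v (Finset.mem_univ i)
    have hcm : (c : ℝ) + 1 ≤ m := by
      have : (c : ℝ) < m := by linarith
      exact_mod_cast this
    have single : ∀ l, l ≠ i → (Pi.single i 1 : α → ℝ) l = 0 := fun l hl => by simp [hl]
    have all : ∀ p : α → Prop, p i → (∀ l, l ≠ i → p l) → ∀ l, p l := by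
      intro p h1 h2 l
      by_cases e : l = i
      · exact e ▸ h1
      · exact h2 l e
    have sone : ∑ l, (Pi.single i 1 : α → ℝ) l = 1 := by simp
    refine key (Pi.single i 1) (1 - v i) (v i) (by linarith) hi0 ?_
      (all _ ?_ ?_) (all _ ?_ ?_) ?_ ?_ (all _ ?_ ?_) (all _ ?_ ?_) ?_ ?_
    · intro l hl
      refine single l ?_
      rintro rfl
      tauto
    · simp
    · intro l hl; rw [single l hl]; linarith [hv0 l]
    · simp
    · intro l hl; rw [single l hl]; linarith [hv1 l]
    · rw [Finset.sum_add_distrib, ← Finset.mul_sum, sone]; linarith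
    · exact ⟨i, hi, Or.inr (by simp)⟩
    · simp
    · intro l hl; rw [single l hl]; linarith [hv0 l]
    · simp
    · intro l hl; rw [single l hl]; linarith [hv1 l]
    · rw [Finset.sum_sub_distrib, ← Finset.mul_sum, sone]; linarith
    · exact ⟨i, hi, Or.inl (by simp)⟩

/-- Signed version of `exists_isFlow`, for supplies with values in `[-1, 1]` and total zero. -/
theorem exists_signed_flow [DecidableEq β] {N : α → Finset β} {m : ℕ}
    (hN : ∀ S : Finset α, S.card ≤ m → S.card ≤ (S.biUnion N).card)
    (hcard : Fintype.card α ≤ 2 * m) {v : α → ℝ} (hv : ∀ i, |v i| ≤ 1) (hsum : ∑ i, v i = 0) :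
    ∃ W : α → β → ℝ, (∀ i, ∀ j ∉ N i, W i j = 0) ∧ (∀ i, ∑ j, W i j = v i) ∧
      (∀ i (t : Finset β), |∑ j ∈ t, W i j| ≤ 1) ∧
      (∀ j (t : Finset α), |∑ i ∈ t, W i j| ≤ 1) := by
  have habs : ∑ i, |v i| ≤ 2 * m := by
    calc ∑ i, |v i| ≤ ∑ _i : α, (1 : ℝ) := Finset.sum_le_sum fun i _ => hv i
      _ = Fintype.card α := by simp
      _ ≤ 2 * m := by exact_mod_cast hcard
  have hp : ∀ i, (v i)⁺ = (|v i| + v i) / 2 := fun i => by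
    linarith [posPart_add_negPart (v i), posPart_sub_negPart (v i)]
  have hn : ∀ i, (v i)⁻ = (|v i| - v i) / 2 := fun i => by
    linarith [posPart_add_negPart (v i), posPart_sub_negPart (v i)]
  have hp1 : ∀ i, (v i)⁺ ≤ 1 := fun i => by
    rw [hp]; linarith [hv i, le_abs_self (v i)]
  have hn1 : ∀ i, (v i)⁻ ≤ 1 := fun i => by
    rw [hn]; linarith [hv i, neg_abs_le (v i)]
  obtain ⟨G, hG⟩ := exists_isFlow hN (v := fun i => (v i)⁺) (fun i => posPart_nonneg _) hp1 (by
    simp only [hp, ← Finset.sum_div, Finset.sum_add_distrib, hsum]; linarith)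
  obtain ⟨H, hH⟩ := exists_isFlow hN (v := fun i => (v i)⁻) (fun i => negPart_nonneg _) hn1 (by
    simp only [hn, ← Finset.sum_div, Finset.sum_sub_distrib, hsum]; linarith)
  have row : ∀ {F : α → β → ℝ} {u : α → ℝ}, IsFlow N u F → ∀ i (t : Finset β),
      0 ≤ ∑ j ∈ t, F i j ∧ ∑ j ∈ t, F i j ≤ u i := fun hF i t =>
    ⟨Finset.sum_nonneg fun j _ => hF.nonneg i j, by
      rw [← hF.supply]
      exact Finset.sum_le_sum_of_subset_of_nonneg (Finset.subset_univ t)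
        fun j _ _ => hF.nonneg i j⟩
  have col : ∀ {F : α → β → ℝ} {u : α → ℝ}, IsFlow N u F → ∀ j (t : Finset α),
      0 ≤ ∑ i ∈ t, F i j ∧ ∑ i ∈ t, F i j ≤ 1 := fun hF j t =>
    ⟨Finset.sum_nonneg fun i _ => hF.nonneg i j,
      (Finset.sum_le_sum_of_subset_of_nonneg (Finset.subset_univ t)
        fun i _ _ => hF.nonneg i j).trans (hF.capacity j)⟩
  refine ⟨fun i j => G i j - H i j, ?_, ?_, ?_, ?_⟩
  · intro i j hj
    simp [hG.support i j hj, hH.support i j hj]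
  · intro i
    rw [Finset.sum_sub_distrib, hG.supply, hH.supply, posPart_sub_negPart]
  · intro i t
    rw [Finset.sum_sub_distrib, abs_le]
    have h1 := row hG i t
    have h2 := row hH i t
    constructor <;> linarith [h1.1, h1.2, h2.1, h2.2, hp1 i, hn1 i]
  · intro j t
    rw [Finset.sum_sub_distrib, abs_le]
    have h1 := col hG j t
    have h2 := col hH j t
    constructor <;> linarith [h1.1, h1.2, h2.1, h2.2]

end Flow

/-- A homogeneous real function on a normed space which is quasilinear with constant `Q`. -/
structure IsQuasilinear {E : Type} [NormedAddCommGroup E] [NormedSpace ℝ E] (Q : ℝ)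
    (ψ : E → ℝ) : Prop where
  map_smul : ∀ (c : ℝ) (a : E), ψ (c • a) = c * ψ a
  map_add : ∀ a b : E, |ψ (a + b) - ψ a - ψ b| ≤ Q * (‖a‖ + ‖b‖)

/-- `ψ` is bounded by `K` on zero-sum families: the condition which characterizes being at distance
at most `K` from a linear functional. -/
def ZeroSumBound {E : Type} [NormedAddCommGroup E] (ψ : E → ℝ) (K : ℝ) : Prop :=
  ∀ (κ : Type) [Fintype κ] (f : κ → E), ∑ i, f i = 0 → |∑ i, ψ (f i)| ≤ K * ∑ i, ‖f i‖

section Quasilinear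

variable {E : Type} [NormedAddCommGroup E] [NormedSpace ℝ E] {Q : ℝ} {ψ : E → ℝ}

theorem IsQuasilinear.map_zero (h : IsQuasilinear Q ψ) : ψ 0 = 0 := by
  simpa using h.map_smul 0 0

theorem IsQuasilinear.map_neg (h : IsQuasilinear Q ψ) (a : E) : ψ (-a) = -ψ a := by
  simpa using h.map_smul (-1) a

theorem IsQuasilinear.abs_map_sum_sub_le (h : IsQuasilinear Q ψ) (hQ : 0 ≤ Q) {κ : Type*}
    (s : Finset κ) (f : κ → E) (hf : ∀ t ⊆ s, ‖∑ i ∈ t, f i‖ ≤ 1) :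
    |ψ (∑ i ∈ s, f i) - ∑ i ∈ s, ψ (f i)| ≤ 2 * Q * s.card := by
  classical
  induction s using Finset.induction_on with
  | empty => simp [h.map_zero]
  | insert i s hi ih =>
    have ih := ih fun t ht => hf t (ht.trans (Finset.subset_insert i s))
    rw [Finset.sum_insert hi, Finset.sum_insert hi, Finset.card_insert_of_notMem hi]
    have h1 := h.map_add (f i) (∑ l ∈ s, f l)
    have h2 : ‖f i‖ ≤ 1 := by
      simpa using hf {i} (by simp)
    have h3 := hf s (Finset.subset_insert i s)
    have h4 : Q * (‖f i‖ + ‖∑ l ∈ s, f l‖) ≤ Q * 2 := by gcongr; linarith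
    have h5 := abs_add_le (ψ (f i + ∑ l ∈ s, f l) - ψ (f i) - ψ (∑ l ∈ s, f l))
      (ψ (∑ l ∈ s, f l) - ∑ l ∈ s, ψ (f l))
    push_cast
    calc _ = |(ψ (f i + ∑ l ∈ s, f l) - ψ (f i) - ψ (∑ l ∈ s, f l)) +
          (ψ (∑ l ∈ s, f l) - ∑ l ∈ s, ψ (f l))| := by congr 1; ring
      _ ≤ _ := by linarith

/-- A nonlinear Hahn–Banach theorem. -/
theorem IsQuasilinear.exists_linear_of_zeroSumBound (h : IsQuasilinear Q ψ) {K : ℝ}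
    (hK : ZeroSumBound ψ K) : ∃ L : E →ₗ[ℝ] ℝ, ∀ a, |ψ a - L a| ≤ K * ‖a‖ := by
  let V (x : E) : Set ℝ := {r | ∃ (κ : Type) (_ : Fintype κ) (f : κ → E),
    ∑ i, f i = x ∧ ∑ i, (ψ (f i) + K * ‖f i‖) = r}
  have hself : ∀ x, ψ x + K * ‖x‖ ∈ V x := fun x => ⟨Unit, inferInstance, fun _ => x, by simp⟩
  have hne : ∀ x, (V x).Nonempty := fun x => ⟨_, hself x⟩
  have hlow : ∀ x, ∀ r ∈ V x, ψ x - K * ‖x‖ ≤ r := by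
    rintro x r ⟨κ, _, f, hf, rfl⟩
    have h1 := hK (Option κ) (fun o => o.elim (-x) f) (by simp [Fintype.sum_option, hf])
    simp only [Fintype.sum_option, Option.elim, norm_neg, h.map_neg] at h1
    rw [Finset.sum_add_distrib, ← Finset.mul_sum]
    linarith [neg_le_of_abs_le h1]
  have hbdd : ∀ x, BddBelow (V x) := fun x => ⟨_, hlow x⟩
  have hsmul_mem : ∀ c : ℝ, 0 < c → ∀ x, ∀ r ∈ V x, c * r ∈ V (c • x) := by
    rintro c hc x r ⟨κ, _, f, hf, rfl⟩
    refine ⟨κ, inferInstance, fun i => c • f i, by rw [← Finset.smul_sum, hf], ?_⟩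
    rw [Finset.mul_sum]
    refine Finset.sum_congr rfl fun i _ => ?_
    rw [h.map_smul, norm_smul, Real.norm_of_nonneg hc.le]
    ring
  have hsmul_le : ∀ c : ℝ, 0 < c → ∀ x, sInf (V (c • x)) ≤ c * sInf (V x) := by
    intro c hc x
    rw [← div_le_iff₀' hc]
    refine le_csInf (hne x) fun r hr => ?_
    rw [div_le_iff₀' hc]
    exact csInf_le (hbdd _) (hsmul_mem c hc x r hr)
  obtain ⟨L, -, hL⟩ := exists_extension_of_le_sublinear (⊥ : E →ₗ.[ℝ] ℝ) (fun x => sInf (V x))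
    (by
      intro c hc x
      refine le_antisymm (hsmul_le c hc x) ?_
      have h1 := hsmul_le c⁻¹ (inv_pos.2 hc) (c • x)
      rw [inv_smul_smul₀ hc.ne', inv_mul_eq_div, le_div_iff₀' hc] at h1
      exact h1)
    (by
      intro x y
      rw [← sub_le_iff_le_add]
      refine le_csInf (hne x) ?_
      rintro r ⟨κ, _, f, hf, rfl⟩
      rw [sub_le_comm]
      refine le_csInf (hne y) ?_
      rintro s ⟨κ', _, g, hg, rfl⟩
      rw [sub_le_iff_le_add']
      refine csInf_le (hbdd _) ⟨κ ⊕ κ', inferInstance, Sum.elim f g, ?_, ?_⟩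
      · simp [hf, hg]
      · simp)
    (by
      rintro ⟨x, hx⟩
      obtain rfl : x = 0 := (Submodule.mem_bot ℝ).1 hx
      refine (LinearPMap.map_zero _).trans_le (le_csInf (hne _) fun r hr => ?_)
      simpa [h.map_zero] using hlow _ r hr)
  refine ⟨L, fun a => ?_⟩
  have h1 := (hL a).trans (csInf_le (hbdd a) (hself a))
  have h2 := (hL (-a)).trans (csInf_le (hbdd (-a)) (hself (-a)))
  rw [h.map_neg, norm_neg, _root_.map_neg] at h2
  rw [abs_le]
  constructor <;> linarith

end Quasilinear

section Sup

variable {ι : Type} [Fintype ι] {Q : ℝ} {ψ : (ι → ℝ) → ℝ}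

theorem IsQuasilinear.exists_bound (h : IsQuasilinear Q ψ) (hQ : 0 ≤ Q) :
    ∃ B, 0 ≤ B ∧ ∀ a, |ψ a| ≤ B * ‖a‖ := by
  classical
  suffices H : ∀ s : Finset ι, ∃ B, 0 ≤ B ∧
      ∀ a : ι → ℝ, |ψ (∑ i ∈ s, a i • Pi.single i (1 : ℝ))| ≤ B * ‖a‖ by
    obtain ⟨B, hB, h⟩ := H Finset.univ
    refine ⟨B, hB, fun a => ?_⟩
    have := h a
    rwa [← pi_eq_sum_univ' a] at this
  intro s
  induction s using Finset.induction_on with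
  | empty => exact ⟨0, le_rfl, fun a => by simp [h.map_zero]⟩
  | insert i s hi ih =>
    obtain ⟨B, hB, ih⟩ := ih
    refine ⟨B + |ψ (Pi.single i 1)| + Q * 2, by positivity, fun a => ?_⟩
    rw [Finset.sum_insert hi]
    have hai : |a i| ≤ ‖a‖ := norm_le_pi_norm a i
    have h1 : ‖a i • (Pi.single i (1 : ℝ) : ι → ℝ)‖ ≤ ‖a‖ := by
      rw [norm_smul, Pi.norm_single]
      simpa using hai
    have h2 : ‖∑ l ∈ s, a l • (Pi.single l (1 : ℝ) : ι → ℝ)‖ ≤ ‖a‖ := by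
      rw [pi_norm_le_iff_of_nonneg (norm_nonneg a)]
      intro l
      rw [Finset.sum_apply]
      simp only [Pi.smul_apply, Pi.single_apply, smul_eq_mul, mul_ite, mul_one, mul_zero,
        Finset.sum_ite_eq]
      split_ifs
      · exact norm_le_pi_norm a l
      · simp
    have h3 := h.map_add (a i • (Pi.single i (1 : ℝ) : ι → ℝ))
      (∑ l ∈ s, a l • (Pi.single l (1 : ℝ) : ι → ℝ))
    have h4 := ih a
    have h5 : |ψ (a i • (Pi.single i (1 : ℝ) : ι → ℝ))| ≤ |ψ (Pi.single i 1)| * ‖a‖ := by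
      rw [h.map_smul, abs_mul, mul_comm]
      gcongr
    have h6 : Q * (‖a i • (Pi.single i (1 : ℝ) : ι → ℝ)‖ +
        ‖∑ l ∈ s, a l • (Pi.single l (1 : ℝ) : ι → ℝ)‖) ≤ Q * (‖a‖ + ‖a‖) := by gcongr
    rw [abs_le] at *
    constructor <;> linarith [h3.1, h3.2, h4.1, h4.2, h5.1, h5.2]

/-- The concentrator argument: regrouping a zero-sum family in the unit ball into three quarters as
many vectors of the unit ball. -/
theorem IsQuasilinear.abs_sum_le_of_norm_le_one (h : IsQuasilinear Q ψ) (hQ : 0 ≤ Q) {K : ℝ}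
    (hK0 : 0 ≤ K) (hK : ZeroSumBound ψ K) (k : ℕ) (f : Fin (4 * k) → ι → ℝ)
    (hf : ∀ i, ‖f i‖ ≤ 1) (hsum : ∑ i, f i = 0) :
    |∑ i, ψ (f i)| ≤ (3 / 4 * K + 48 * Q) * (4 * k : ℕ) := by
  classical
  obtain ⟨N, hN, hHall⟩ := exists_concentrator k
  have hflow := fun ω : ι => exists_signed_flow hHall (by simp; omega) (v := fun i => f i ω)
    (fun i => (norm_le_pi_norm (f i) ω).trans (hf i)) (by simpa using congrFun hsum ω)
  choose W hW0 hWf hWr hWc using hflow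
  let w (i : Fin (4 * k)) (j : Fin (3 * k)) : ι → ℝ := fun ω => W ω i j
  have hw0 : ∀ i, ∀ j ∉ N i, w i j = 0 := fun i j hj => funext fun ω => hW0 ω i j hj
  have hwr : ∀ i (t : Finset (Fin (3 * k))), ‖∑ j ∈ t, w i j‖ ≤ 1 := fun i t => by
    rw [pi_norm_le_iff_of_nonneg zero_le_one]
    intro ω
    simpa [w] using hWr ω i t
  have hwc : ∀ j (t : Finset (Fin (4 * k))), ‖∑ i ∈ t, w i j‖ ≤ 1 := fun j t => by
    rw [pi_norm_le_iff_of_nonneg zero_le_one]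
    intro ω
    simpa [w] using hWc ω j t
  let I (j : Fin (3 * k)) : Finset (Fin (4 * k)) := Finset.univ.filter fun i => j ∈ N i
  have hwf : ∀ i, ∑ j ∈ N i, w i j = f i := fun i => by
    rw [Finset.sum_subset (Finset.subset_univ _) fun j _ hj => hw0 i j hj]
    funext ω
    simpa [w] using hWf ω i
  have hswap : ∀ {M : Type} [AddCommMonoid M] (F : Fin (4 * k) → Fin (3 * k) → M),
      ∑ i, ∑ j ∈ N i, F i j = ∑ j, ∑ i ∈ I j, F i j := fun F =>
    Finset.sum_comm' (by simp [I])
  let b (j : Fin (3 * k)) : ι → ℝ := ∑ i ∈ I j, w i j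
  have hb : ∑ j, b j = 0 := by
    rw [← hswap w, Finset.sum_congr rfl fun i _ => hwf i, hsum]
  have hedges : ∑ i, ((N i).card : ℝ) ≤ 12 * (4 * k : ℕ) := by
    refine (Finset.sum_le_card_nsmul _ _ 12 fun i _ => by exact_mod_cast hN i).trans ?_
    simp [mul_comm]
  have hedges' : ∑ j, ((I j).card : ℝ) = ∑ i, ((N i).card : ℝ) := by
    simpa using (hswap fun _ _ => (1 : ℝ)).symm
  have h1 : |∑ i, ψ (f i) - ∑ i, ∑ j ∈ N i, ψ (w i j)| ≤ 2 * Q * ∑ i, ((N i).card : ℝ) := by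
    rw [← Finset.sum_sub_distrib, Finset.mul_sum]
    refine (Finset.abs_sum_le_sum_abs _ _).trans (Finset.sum_le_sum fun i _ => ?_)
    have := h.abs_map_sum_sub_le hQ (N i) (w i) fun t _ => hwr i t
    rwa [hwf] at this
  have h2 : |∑ j, ψ (b j) - ∑ j, ∑ i ∈ I j, ψ (w i j)| ≤ 2 * Q * ∑ j, ((I j).card : ℝ) := by
    rw [← Finset.sum_sub_distrib, Finset.mul_sum]
    refine (Finset.abs_sum_le_sum_abs _ _).trans (Finset.sum_le_sum fun j _ => ?_)
    exact h.abs_map_sum_sub_le hQ (I j) (fun i => w i j) fun t _ => hwc j t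
  have h3 : |∑ j, ψ (b j)| ≤ K * (3 * k : ℕ) := by
    refine (hK _ b hb).trans ?_
    gcongr
    refine (Finset.sum_le_card_nsmul _ _ 1 fun j _ => hwc j (I j)).trans ?_
    simp
  rw [hedges', ← hswap fun i j => ψ (w i j)] at h2
  have h4 : 2 * Q * ∑ i, ((N i).card : ℝ) ≤ 2 * Q * (12 * (4 * k : ℕ)) := by gcongr
  push_cast at *
  rw [abs_le] at *
  constructor <;> linarith [h1.1, h1.2, h2.1, h2.2, h3.1, h3.2]

theorem IsQuasilinear.zeroSumBound_improve (h : IsQuasilinear Q ψ) (hQ : 0 ≤ Q) {K : ℝ}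
    (hK0 : 0 ≤ K) (hK : ZeroSumBound ψ K) : ZeroSumBound ψ (3 / 4 * K + 48 * Q) := by
  intro κ _ f hf
  set K' := 3 / 4 * K + 48 * Q with hK'
  have hK'0 : 0 ≤ K' := by positivity
  have main : ∀ n : ℕ, (n : ℝ) * |∑ i, ψ (f i)| ≤
      K' * (n * ∑ i, ‖f i‖ + 2 * Fintype.card κ) := by
    intro n
    let d (i : κ) : ℕ := ⌈(n : ℝ) * ‖f i‖⌉₊ + 1
    have hd : ∀ i, (0 : ℝ) < d i := fun i => by positivity
    have hdle : ∀ i, (d i : ℝ) ≤ n * ‖f i‖ + 2 := fun i => by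
      have := Nat.ceil_lt_add_one (a := (n : ℝ) * ‖f i‖) (by positivity)
      simp only [d]
      push_cast
      linarith
    have hcard : Fintype.card (Σ i : κ, Fin (4 * d i)) = 4 * ∑ i, d i := by
      simp [Finset.mul_sum]
    let e := Fintype.equivFinOfCardEq hcard
    let g (p : Σ i : κ, Fin (4 * d i)) : ι → ℝ := ((n : ℝ) / d p.1) • f p.1
    have hg : ∀ p, ‖g p‖ ≤ 1 := fun p => by
      simp only [g]
      rw [norm_smul, Real.norm_of_nonneg (by positivity), div_mul_eq_mul_div,
        div_le_one (hd _)]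
      simp only [d]
      push_cast
      linarith [Nat.le_ceil ((n : ℝ) * ‖f p.1‖)]
    have hgsum : ∑ p, g p = 0 := by
      rw [Fintype.sum_sigma]
      have : ∀ i, ∑ t : Fin (4 * d i), g ⟨i, t⟩ = (4 * n : ℝ) • f i := fun i => by
        simp only [g, Finset.sum_const, Finset.card_univ, Fintype.card_fin]
        rw [← Nat.cast_smul_eq_nsmul ℝ, smul_smul]
        congr 1
        have := (hd i).ne'
        push_cast
        field_simp
      simp only [this, ← Finset.smul_sum, hf, smul_zero]
    have hψsum : ∑ p, ψ (g p) = 4 * n * ∑ i, ψ (f i) := by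
      rw [Fintype.sum_sigma, Finset.mul_sum]
      refine Finset.sum_congr rfl fun i _ => ?_
      simp only [g, h.map_smul, Finset.sum_const, Finset.card_univ, Fintype.card_fin,
        nsmul_eq_mul]
      have := (hd i).ne'
      push_cast
      field_simp
    have key := h.abs_sum_le_of_norm_le_one hQ hK0 hK (∑ i, d i) (fun l => g (e.symm l))
      (fun l => hg _) (by rw [Equiv.sum_comp e.symm g, hgsum])
    rw [Equiv.sum_comp e.symm (fun p => ψ (g p)), hψsum, abs_mul,
      abs_of_nonneg (by positivity : (0 : ℝ) ≤ 4 * n)] at key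
    have hdsum : ((∑ i, d i : ℕ) : ℝ) ≤ n * ∑ i, ‖f i‖ + 2 * Fintype.card κ := by
      push_cast
      refine (Finset.sum_le_sum fun i _ => hdle i).trans ?_
      rw [Finset.sum_add_distrib, Finset.mul_sum]
      simp [mul_comm]
    have := mul_le_mul_of_nonneg_left hdsum hK'0
    rw [Nat.cast_mul, Nat.cast_ofNat, ← hK'] at key
    linarith
  by_contra! hlt
  obtain ⟨n, hn⟩ := exists_nat_gt
    (K' * (2 * Fintype.card κ) / (|∑ i, ψ (f i)| - K' * ∑ i, ‖f i‖))
  rw [div_lt_iff₀ (by linarith)] at hn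
  linarith [main n]

theorem IsQuasilinear.zeroSumBound (h : IsQuasilinear Q ψ) (hQ : 0 ≤ Q) :
    ZeroSumBound ψ (192 * Q) := by
  obtain ⟨B, hB, hψ⟩ := h.exists_bound hQ
  have iter : ∀ n : ℕ, ZeroSumBound ψ (192 * Q + (3 / 4) ^ n * B) := by
    intro n
    induction n with
    | zero =>
      intro κ _ f _
      refine (Finset.abs_sum_le_sum_abs _ _).trans ?_
      rw [Finset.mul_sum]
      refine Finset.sum_le_sum fun i _ => (hψ (f i)).trans ?_
      gcongr
      simp [hQ]
    | succ n ih =>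
      have := h.zeroSumBound_improve hQ (by positivity) ih
      convert this using 1
      ring
  intro κ _ f hf
  have hlim : Filter.Tendsto (fun n : ℕ => (192 * Q + (3 / 4 : ℝ) ^ n * B) * ∑ i, ‖f i‖)
      Filter.atTop (nhds ((192 * Q + 0 * B) * ∑ i, ‖f i‖)) :=
    (((tendsto_pow_atTop_nhds_zero_of_lt_one (by norm_num) (by norm_num)).mul_const B).const_add
      _).mul_const _
  rw [zero_mul, add_zero] at hlim
  exact ge_of_tendsto' hlim fun n => iter n κ f hf

/-- Quasilinear functionals on finite-dimensional `ℓ_∞` are uniformly close to linear ones. -/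
theorem IsQuasilinear.exists_linear (h : IsQuasilinear Q ψ) (hQ : 0 ≤ Q) :
    ∃ L : (ι → ℝ) →ₗ[ℝ] ℝ, ∀ a, |ψ a - L a| ≤ 192 * Q * ‖a‖ :=
  h.exists_linear_of_zeroSumBound (h.zeroSumBound hQ)

end Sup

/-- A relation stable under simultaneous scaling which has a solution over every point has a
homogeneous selection. -/
theorem exists_homogeneous_selection {V W : Type*} [AddCommGroup V] [Module ℝ V] [AddCommGroup W]
    [Module ℝ W] (S : V → Prop) (R : V → W → Prop) (hS : ∀ (c : ℝ) x, S x → S (c • x))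
    (hR : ∀ (c : ℝ) x y, S x → R x y → R (c • x) (c • y)) (hex : ∀ x, S x → ∃ y, R x y) :
    ∃ Φ : V → W, (∀ x, S x → R x (Φ x)) ∧ ∀ (c : ℝ) x, S x → Φ (c • x) = c • Φ x := by
  classical
  have hex' : ∀ x, ∃ y, S x → R x y := fun x => by
    by_cases h : S x
    · exact (hex x h).imp fun _ hy _ => hy
    · exact ⟨0, fun h' => absurd h' h⟩
  choose Y hY using hex'
  have hcoef : ∀ x : V, ∀ hx : x ≠ 0, ∃ c : ℝ, c • (Projectivization.mk ℝ x hx).rep = x := by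
    intro x hx
    obtain ⟨u, hu⟩ := Projectivization.exists_smul_eq_mk_rep ℝ x hx
    exact ⟨(u⁻¹ : ℝˣ), by rw [← hu]; exact inv_smul_smul u x⟩
  choose coef hcoef using hcoef
  let Φ (x : V) : W :=
    if hx : x = 0 then 0 else coef x hx • Y (Projectivization.mk ℝ x hx).rep
  refine ⟨Φ, fun x hx => ?_, fun c x _ => ?_⟩
  · by_cases h : x = 0
    · subst h
      simpa [Φ] using hR 0 0 _ hx (hY 0 hx)
    · have hrep : S (Projectivization.mk ℝ x h).rep := by
        obtain ⟨u, hu⟩ := Projectivization.exists_smul_eq_mk_rep ℝ x h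
        rw [← hu]
        exact hS u x hx
      have := hR (coef x h) _ _ hrep (hY _ hrep)
      rw [hcoef] at this
      simpa [Φ, h] using this
  · by_cases h : x = 0
    · simp [Φ, h]
    by_cases hc : c = 0
    · simp [Φ, hc]
    have hcx : c • x ≠ 0 := smul_ne_zero hc h
    have hmk : Projectivization.mk ℝ (c • x) hcx = Projectivization.mk ℝ x h :=
      (Projectivization.mk_eq_mk_iff' ℝ _ _ _ _).2 ⟨c, rfl⟩
    have h1 := hcoef (c • x) hcx
    nth_rw 3 [← hcoef x h] at h1
    rw [hmk, smul_smul] at h1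
    have h2 := smul_left_injective ℝ (Projectivization.rep_nonzero (Projectivization.mk ℝ x h)) h1
    simp only [Φ, h, hcx, dif_neg, not_false_eq_true, hmk]
    rw [h2, mul_smul]

theorem Linf.abs_apply_le_norm (a : Linf) (n : ℕ) : |a n| ≤ ‖a‖ :=
  lp.norm_apply_le_norm ENNReal.top_ne_zero a n

/-- Extension by zero of a function on a finite set to a bounded sequence. -/
noncomputable def extendByZero (A : Finset ℕ) : (A → ℝ) →ₗ[ℝ] Linf where
  toFun v := ⟨fun n => if h : n ∈ A then v ⟨n, h⟩ else 0, by
    apply memℓp_infty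
    refine ⟨‖v‖, ?_⟩
    rintro r ⟨n, rfl⟩
    dsimp only
    split_ifs with h
    · exact norm_le_pi_norm v ⟨n, h⟩
    · simp⟩
  map_add' u v := by
    ext n
    rw [lp.coeFn_add, Pi.add_apply]
    by_cases h : n ∈ A <;> simp [h]
  map_smul' c v := by
    ext n
    by_cases h : n ∈ A <;> simp [h]

theorem extendByZero_apply (A : Finset ℕ) (v : A → ℝ) (n : ℕ) :
    extendByZero A v n = if h : n ∈ A then v ⟨n, h⟩ else 0 := rfl

theorem norm_extendByZero_le (A : Finset ℕ) (v : A → ℝ) : ‖extendByZero A v‖ ≤ ‖v‖ := by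
  refine lp.norm_le_of_forall_le (norm_nonneg v) fun n => ?_
  rw [extendByZero_apply]
  split_ifs with h
  · exact norm_le_pi_norm v ⟨n, h⟩
  · simp

section Module

variable {X : Type} [NormedAddCommGroup X] [Module Linf X]

theorem FinSuppX.smul {x : X} (hx : FinSuppX x) (a : Linf) : FinSuppX (a • x) := by
  obtain ⟨A, hA⟩ := hx
  exact ⟨A, by rw [smul_smul, mul_comm, mul_smul, hA]⟩

theorem FinSuppX.real_smul [NormedSpace ℝ X] [IsScalarTower ℝ Linf X] {x : X}
    (hx : FinSuppX x) (c : ℝ) : FinSuppX (c • x) := by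
  have h := hx.smul (c • (1 : Linf))
  rwa [smul_assoc, one_smul] at h

/-- The functional `a ↦ φ (a • x)` is within `K * ‖a‖ * ‖x‖` of the functional induced by the
finitely supported sequence `y`. -/
def Represents (K : ℝ) (φ : X → ℝ) (x : X) (y : ℕ → ℝ) : Prop :=
  y.support.Finite ∧ ∀ a : Linf, |φ (a • x) - ∑' n, a n * y n| ≤ K * ‖a‖ * ‖x‖

theorem exists_represents [NormedSpace ℝ X] [IsScalarTower ℝ Linf X] {Q : ℝ} (hQ : 0 ≤ Q)
    (hX : ∀ (a : Linf) (x : X), ‖a • x‖ ≤ ‖a‖ * ‖x‖) {φ : X → ℝ}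
    (hφ : ∀ (c : ℝ) (x : X), FinSuppX x → φ (c • x) = c * φ x)
    (hφQ : ∀ x y : X, FinSuppX x → FinSuppX y → |φ (x + y) - φ x - φ y| ≤ Q * (‖x‖ + ‖y‖))
    {x : X} (hx : FinSuppX x) : ∃ y, Represents (192 * Q) φ x y := by
  obtain ⟨A, hA⟩ := id hx
  have hnorm : ∀ v : A → ℝ, ‖extendByZero A v • x‖ ≤ ‖v‖ * ‖x‖ := fun v =>
    (hX _ _).trans (by gcongr; exact norm_extendByZero_le A v)
  have hψ : IsQuasilinear (Q * ‖x‖) fun v : A → ℝ => φ (extendByZero A v • x) :=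
    { map_smul := fun c v => by
        rw [map_smul, smul_assoc, hφ c _ (hx.smul _)]
      map_add := fun u v => by
        rw [map_add, add_smul]
        refine (hφQ _ _ (hx.smul _) (hx.smul _)).trans ?_
        rw [mul_assoc, mul_add ‖x‖, mul_comm ‖x‖, mul_comm ‖x‖]
        gcongr
        · exact hnorm u
        · exact hnorm v }
  obtain ⟨L, hL⟩ := hψ.exists_linear (by positivity)
  let y (n : ℕ) : ℝ := if h : n ∈ A then L (Pi.single ⟨n, h⟩ 1) else 0
  have hy : ∀ n ∉ A, y n = 0 := fun n hn => by simp [y, hn]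
  refine ⟨y, A.finite_toSet.subset fun n hn => by_contra fun h => hn (hy n h), fun a => ?_⟩
  have h1 : a • x = extendByZero A (fun i => a i) • x := by
    rw [← hA, smul_smul, smul_smul]
    congr 1
    ext n
    rw [lp.infty_coeFn_mul, lp.infty_coeFn_mul]
    simp only [Pi.mul_apply, extendByZero_apply]
    by_cases h : n ∈ A <;> simp [indLp, h]
  have h2 : ∑' n, a n * y n = L (fun i : A => a i) := by
    rw [tsum_eq_sum (s := A) fun n hn => by rw [hy n hn, mul_zero], ← Finset.sum_coe_sort A,
      LinearMap.pi_apply_eq_sum_univ L]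
    refine Finset.sum_congr rfl fun i _ => ?_
    simp only [y, Finset.coe_mem, dif_pos, smul_eq_mul, Subtype.coe_eta]
    congr 2
    funext j
    simp [Pi.single_apply, eq_comm]
  have h3 : ‖fun i : A => a i‖ ≤ ‖a‖ :=
    (pi_norm_le_iff_of_nonneg (norm_nonneg a)).2 fun i => Linf.abs_apply_le_norm a i
  rw [h1, h2]
  refine (hL _).trans ?_
  calc 192 * (Q * ‖x‖) * ‖fun i : A => a i‖ ≤ 192 * (Q * ‖x‖) * ‖a‖ := by gcongr
    _ = 192 * Q * ‖a‖ * ‖x‖ := by ring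

theorem Represents.smul [NormedSpace ℝ X] [IsScalarTower ℝ Linf X] {K : ℝ} {φ : X → ℝ}
    (hφ : ∀ (c : ℝ) (x : X), FinSuppX x → φ (c • x) = c * φ x) {x : X} {y : ℕ → ℝ}
    (hx : FinSuppX x) (h : Represents K φ x y) (c : ℝ) : Represents K φ (c • x) (c • y) := by
  refine ⟨h.1.subset (Function.support_const_smul_subset c y), fun a => ?_⟩
  have h1 : a • c • x = c • a • x := by
    have hc : c • x = (c • (1 : Linf)) • x := by rw [smul_assoc, one_smul]
    rw [hc, smul_smul, mul_smul_comm, mul_one, smul_assoc]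
  have h2 : ∑' n, a n * (c • y) n = c * ∑' n, a n * y n := by
    rw [← tsum_mul_left]
    refine tsum_congr fun n => ?_
    simp only [Pi.smul_apply, smul_eq_mul]
    ring
  rw [h1, h2, hφ c _ (hx.smul a), ← mul_sub, abs_mul, norm_smul, Real.norm_eq_abs]
  calc |c| * |φ (a • x) - ∑' n, a n * y n| ≤ |c| * (K * ‖a‖ * ‖x‖) := by gcongr; exact h.2 a
    _ = K * ‖a‖ * (|c| * ‖x‖) := by ring

/-- Sequences representing `x` and `b • x` are related by `b` up to a bounded `ℓ₁`-error. -/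
theorem Represents.l1Norm_sub_le {K : ℝ} (hK : 0 ≤ K)
    (hX : ∀ (a : Linf) (x : X), ‖a • x‖ ≤ ‖a‖ * ‖x‖) {φ : X → ℝ} {x : X} {b : Linf}
    {y z : ℕ → ℝ} (hy : Represents K φ x y) (hz : Represents K φ (b • x) z) :
    l1Norm (fun n => z n - b n * y n) ≤ 2 * K * ‖b‖ * ‖x‖ := by
  have hsign : ∀ t : ℝ, |(SignType.sign t : ℝ)| ≤ 1 := fun t => by
    rcases lt_trichotomy t 0 with h | h | h <;> simp [h]
  let s : Linf := ⟨fun n => (SignType.sign (z n - b n * y n) : ℝ), by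
    apply memℓp_infty
    refine ⟨1, ?_⟩
    rintro r ⟨n, rfl⟩
    exact hsign _⟩
  have hs_apply : ∀ n, s n = (SignType.sign (z n - b n * y n) : ℝ) := fun n => rfl
  have hs : ‖s‖ ≤ 1 := lp.norm_le_of_forall_le zero_le_one fun n => hsign _
  have hsum : ∀ (a : Linf) {w : ℕ → ℝ}, w.support.Finite → Summable fun n => a n * w n :=
    fun a w hw => summable_of_hasFiniteSupport (hw.subset fun n hn hwn => hn (by simp [hwn]))
  have h1 : l1Norm (fun n => z n - b n * y n) =
      ∑' n, s n * z n - ∑' n, (s * b) n * y n := by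
    rw [← (hsum s hz.1).tsum_sub (hsum (s * b) hy.1), l1Norm]
    refine tsum_congr fun n => ?_
    rw [lp.infty_coeFn_mul, Pi.mul_apply, mul_assoc, ← mul_sub, hs_apply, sign_mul_self]
  have h2 := hz.2 s
  have h3 := hy.2 (s * b)
  rw [smul_smul] at h2
  have h4 : K * ‖s‖ * ‖b • x‖ ≤ K * 1 * (‖b‖ * ‖x‖) := by
    gcongr
    exact hX b x
  have h5 : K * ‖s * b‖ * ‖x‖ ≤ K * (1 * ‖b‖) * ‖x‖ := by
    gcongr
    exact (norm_mul_le s b).trans (by gcongr)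
  rw [h1]
  rw [abs_le] at h2 h3
  linarith [h2.1, h3.2]

end Module

/-- Let `X` be a real Banach space which is a module over `ℓ_∞` (the
module multiplication being bilinear, with `‖a • x‖ ≤ ‖a‖_∞‖x‖` and `1 • x = x`), with
`X⁰` its submodule of finitely supported elements, and let `φ : X⁰ → ℝ` be a homogeneous
quasilinear map with constant `Q`. Then there are a homogeneous map `Φ : X⁰ → ℓ₁` and
constants `C, C'` depending only on `Q` such that
`‖Φ(a • x) − a·Φ(x)‖₁ ≤ C'‖a‖_∞‖x‖` (so `Φ` is a centralizer) and
`|φ(x) − Σₙ Φ(x)(n)| ≤ C‖x‖` for all `x ∈ X⁰`. -/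
theorem quasilinear_functional_comes_from_centralizer (Q : ℝ) :
    ∃ C C' : ℝ,
      ∀ (X : Type) [NormedAddCommGroup X] [NormedSpace ℝ X]
        [CompleteSpace X] [Module Linf X] [IsScalarTower ℝ Linf X],
        (∀ (a : Linf) (x : X), ‖a • x‖ ≤ ‖a‖ * ‖x‖) →
        ∀ φ : X → ℝ,
          (∀ (c : ℝ) (x : X), FinSuppX x → φ (c • x) = c * φ x) →
          (∀ x y : X, FinSuppX x → FinSuppX y →
            |φ (x + y) - φ x - φ y| ≤ Q * (‖x‖ + ‖y‖)) →
          ∃ Φ : X → ℕ → ℝ,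
            (∀ x : X, FinSuppX x → Summable (fun n => |Φ x n|)) ∧
            (∀ (c : ℝ) (x : X), FinSuppX x → Φ (c • x) = c • Φ x) ∧
            (∀ (a : Linf) (x : X), FinSuppX x →
              l1Norm (fun n => Φ (a • x) n - a n * Φ x n) ≤ C' * ‖a‖ * ‖x‖) ∧
            (∀ x : X, FinSuppX x → |φ x - ∑' n, Φ x n| ≤ C * ‖x‖) := by
  refine ⟨192 * |Q|, 2 * (192 * |Q|), ?_⟩
  intro X _ _ _ _ _ hX φ hφ hφQ
  have hφQ' : ∀ x y : X, FinSuppX x → FinSuppX y →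
      |φ (x + y) - φ x - φ y| ≤ |Q| * (‖x‖ + ‖y‖) := fun x y hx hy =>
    (hφQ x y hx hy).trans (by gcongr; exact le_abs_self Q)
  obtain ⟨Φ, hΦ, hhom⟩ := exists_homogeneous_selection (FinSuppX (X := X))
    (Represents (192 * |Q|) φ) (fun c x hx => hx.real_smul c) (fun c x y hx h => h.smul hφ hx c)
    (fun x hx => exists_represents (abs_nonneg Q) hX hφ hφQ' hx)
  refine ⟨Φ, fun x hx => ?_, hhom, fun a x hx => ?_, fun x hx => ?_⟩
  · exact summable_of_hasFiniteSupport ((hΦ x hx).1.subset fun n hn h => hn (by simp [h]))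
  · exact (hΦ x hx).l1Norm_sub_le (by positivity) hX (hΦ _ (hx.smul a))
  · simpa using (hΦ x hx).2 1
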